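/- (Adams trace inequality, measure form) Let Ω ⊂ ℝⁿ be bounded, 1 < r < s < ∞, r < n, α₀ = (s/r)(n−r), and let μ be a positive Radon measure supported in Ω with μ(B_ρ(x)) ≤ K ρ^{α₀} for all x ∈ ℝⁿ and ρ > 0. Then for all v ∈ W_0^{1,r}(Ω), (∫_Ω |v|^s dμ)^{1/s} ≤ C(n,s,r) K^{1/s} (∫_Ω |Dv|^r dx)^{1/r}. -/

import Mathlib

open MeasureTheory Metric Set
open scoped ENNReal NNReal

noncomputable section

open Filter Topology

section Truncation

variable {E : Type*} [NormedAddCommGroup E] [NormedSpace ℝ E]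

theorem deriv_smoothTransition_eq_zero {t : ℝ} (ht : t ∉ Ico (0 : ℝ) 1) :
    deriv Real.smoothTransition t = 0 := by
  rw [mem_Ico, not_and_or, not_le, not_lt] at ht
  rcases ht with ht | ht
  · refine IsLocalMin.deriv_eq_zero (Eventually.of_forall fun y => ?_)
    simpa [Real.smoothTransition.zero_of_nonpos ht.le] using Real.smoothTransition.nonneg y
  · refine IsLocalMax.deriv_eq_zero (Eventually.of_forall fun y => ?_)
    simpa [Real.smoothTransition.one_of_one_le ht] using Real.smoothTransition.le_one y

/-- A smooth truncation of `v` between levels has gradient supported in the corresponding layer. -/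
theorem exists_norm_fderiv_smoothTransition_le :
    ∃ L > (0 : ℝ), ∀ v : E → ℝ, ContDiff ℝ 1 v → ∀ a > (0 : ℝ), ∀ x,
      ‖fderiv ℝ (fun x => Real.smoothTransition (v x ^ 2 / a - 1)) x‖ ≤
        {x | v x ^ 2 ∈ Ico a (2 * a)}.indicator
          (fun x => L * a ^ (-(1 / 2) : ℝ) * ‖fderiv ℝ v x‖) x := by
  have hφ : ContDiff ℝ 1 Real.smoothTransition := Real.smoothTransition.contDiff (n := 1)
  obtain ⟨L, hL⟩ := isCompact_Icc.exists_bound_of_continuousOn (s := Icc (0 : ℝ) 1)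
    (hφ.continuous_deriv le_rfl).continuousOn
  refine ⟨4 * max L 1, by positivity, fun v hv a ha x => ?_⟩
  have hvd := hv.differentiable one_ne_zero x
  have hder : HasFDerivAt (fun x => Real.smoothTransition (v x ^ 2 / a - 1))
      ((deriv Real.smoothTransition (v x ^ 2 / a - 1) * (2 * v x / a)) • fderiv ℝ v x) x := by
    have h1 : HasDerivAt (fun y : ℝ => y ^ 2 / a - 1) (2 * v x / a) (v x) := by
      simpa using ((hasDerivAt_pow 2 (v x)).div_const a).sub_const 1
    have h2 := (hφ.differentiable one_ne_zero (v x ^ 2 / a - 1)).hasDerivAt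
    exact (h2.comp (v x) h1).comp_hasFDerivAt x hvd.hasFDerivAt
  rw [hder.fderiv]
  by_cases hx : v x ^ 2 ∈ Ico a (2 * a)
  · rw [indicator_of_mem (by exact hx), norm_smul, norm_mul]
    have h1 : ‖deriv Real.smoothTransition (v x ^ 2 / a - 1)‖ ≤ max L 1 := by
      refine (hL _ ⟨?_, ?_⟩).trans (le_max_left _ _)
      · rw [sub_nonneg, one_le_div ha]; exact hx.1
      · have : v x ^ 2 / a ≤ 2 := by rw [div_le_iff₀ ha]; exact hx.2.le
        linarith
    have h2 : ‖2 * v x / a‖ ≤ 4 * a ^ (-(1 / 2) : ℝ) := by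
      have h3 : a ^ (-(1 / 2) : ℝ) * a ^ (-(1 / 2) : ℝ) = a⁻¹ := by
        rw [← Real.rpow_add ha, ← Real.rpow_neg_one]; norm_num
      refine abs_le_of_sq_le_sq ?_ (by positivity)
      have h4 : (2 * v x / a) ^ 2 = 4 * (v x ^ 2) / a ^ 2 := by ring
      have h5 : (4 * a ^ (-(1 / 2) : ℝ)) ^ 2 = 16 * a⁻¹ := by rw [← h3]; ring
      rw [h4, h5, div_le_iff₀ (by positivity)]
      have h6 : 16 * a⁻¹ * a ^ 2 = 16 * a := by field_simp
      rw [h6]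
      linarith [hx.2]
    calc _ ≤ max L 1 * (4 * a ^ (-(1 / 2) : ℝ)) * ‖fderiv ℝ v x‖ := by gcongr
      _ = _ := by ring
  · rw [indicator_of_notMem (by exact hx), deriv_smoothTransition_eq_zero]
    · simp
    · intro h
      refine hx ⟨?_, ?_⟩
      · rw [← one_le_div ha]; linarith [h.1]
      · rw [← div_lt_iff₀ ha]; linarith [h.2]

end Truncation

theorem tsum_rpow_le_rpow_tsum {ι : Type*} (f : ι → ℝ≥0∞) {p : ℝ} (hp : 1 ≤ p) :
    ∑' i, f i ^ p ≤ (∑' i, f i) ^ p := by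
  have hsplit : ∀ a : ℝ≥0∞, a ^ p = a * a ^ (p - 1) := fun a => by
    nth_rewrite 2 [← ENNReal.rpow_one a]
    rw [← ENNReal.rpow_add_of_nonneg _ _ zero_le_one (by linarith)]
    congr 1
    ring
  calc ∑' i, f i ^ p ≤ ∑' i, f i * (∑' j, f j) ^ (p - 1) := by
        refine ENNReal.tsum_le_tsum fun i => ?_
        rw [hsplit]
        gcongr
        exact ENNReal.le_tsum i
    _ = _ := by rw [ENNReal.tsum_mul_right, ← hsplit]

theorem sub_le_sub_of_norm_deriv_le {f f' B B' : ℝ → ℝ} {a b : ℝ} (hab : a ≤ b)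
    (hf : ∀ t, HasDerivAt f (f' t) t) (hBc : ContinuousOn B (Icc a b))
    (hB : ∀ t ∈ Ioo a b, HasDerivAt B (B' t) t) (h : ∀ t ∈ Ioo a b, ‖f' t‖ ≤ B' t) :
    f a - f b ≤ B b - B a := by
  have hmono : MonotoneOn (fun t => f t + B t) (Icc a b) := by
    refine monotoneOn_of_hasDerivWithinAt_nonneg (f' := fun t => f' t + B' t) (convex_Icc a b)
      (ContinuousOn.add (fun t _ => (hf t).continuousAt.continuousWithinAt) hBc) ?_ ?_
    · intro t ht
      rw [interior_Icc] at ht ⊢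
      exact ((hf t).add (hB t ht)).hasDerivWithinAt
    · intro t ht
      rw [interior_Icc] at ht
      have := (abs_le.1 (h t ht)).1
      linarith
  have := hmono (left_mem_Icc.2 hab) (right_mem_Icc.2 hab) hab
  simp only at this
  linarith

theorem rpow_inv_mul_div_rpow_eq {d : ℕ} {r k δ R ρ : ℝ} (hr : 0 < r) (hk : 0 ≤ k) (hR : 0 < R)
    (hρ : 0 < ρ) :
    ((ρ ^ d)⁻¹ * (k ^ r * ρ ^ ((d : ℝ) - r) * (ρ / R) ^ δ)) ^ (1 / r) =
      k * ((ρ / R) ^ (δ / r) / ρ) := by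
  have h1 : (ρ ^ d)⁻¹ * (k ^ r * ρ ^ ((d : ℝ) - r) * (ρ / R) ^ δ)
      = (k * ((ρ / R) ^ (δ / r) / ρ)) ^ r := by
    rw [Real.mul_rpow hk (by positivity), Real.div_rpow (by positivity) hρ.le,
      ← Real.rpow_mul (by positivity), div_mul_cancel₀ _ hr.ne', Real.rpow_sub hρ,
      Real.rpow_natCast]
    field_simp
  rw [h1, one_div, Real.rpow_rpow_inv (by positivity) hr.ne']

theorem rpow_inv_mul_rpow_eq {d : ℕ} {r k R ρ : ℝ} (hr : 0 < r) (hk : 0 ≤ k) (hR : 0 < R)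
    (hρ : 0 < ρ) :
    ((ρ ^ d)⁻¹ * (k ^ r * R ^ ((d : ℝ) - r))) ^ (1 / r) =
      k * R ^ (d / r - 1) * ρ ^ (-(d / r) : ℝ) := by
  have h1 : (ρ ^ d)⁻¹ * (k ^ r * R ^ ((d : ℝ) - r))
      = (k * R ^ (d / r - 1) * ρ ^ (-(d / r) : ℝ)) ^ r := by
    rw [Real.mul_rpow (by positivity) (by positivity), Real.mul_rpow hk (by positivity),
      ← Real.rpow_mul hρ.le, ← Real.rpow_mul hR.le, neg_mul, div_mul_cancel₀ _ hr.ne', sub_mul,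
      div_mul_cancel₀ _ hr.ne', one_mul, Real.rpow_neg hρ.le, Real.rpow_natCast]
    ring
  rw [h1, one_div, Real.rpow_rpow_inv (by positivity) hr.ne']

section Trace

open Module

variable {E : Type*} [NormedAddCommGroup E] [NormedSpace ℝ E] [FiniteDimensional ℝ E]
  [MeasurableSpace E] [BorelSpace E]

theorem hasDerivAt_setIntegral_dilation (ν : Measure E) [IsFiniteMeasureOnCompacts ν] {w : E → ℝ}
    (hw : ContDiff ℝ 1 w) (hc : HasCompactSupport w) {S : Set E}
    (hSm : MeasurableSet S) (hS : S ⊆ closedBall 0 1) (x : E) (t : ℝ) :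
    HasDerivAt (fun t : ℝ => ∫ z in S, w (x + t • z) ∂ν)
      (∫ z in S, fderiv ℝ w (x + t • z) z ∂ν) t := by
  have hDc : Continuous (fderiv ℝ w) := hw.continuous_fderiv (by norm_num)
  obtain ⟨C, hC⟩ := hDc.bounded_above_of_compact_support (hc.fderiv (𝕜 := ℝ))
  have hSfin : ν S < ∞ := (measure_mono hS).trans_lt (isCompact_closedBall 0 1).measure_lt_top
  have hcomp : ∀ s : ℝ, Continuous fun z : E => w (x + s • z) := fun s =>
    hw.continuous.comp (by fun_prop)
  have hint : ∀ s : ℝ, IntegrableOn (fun z : E => w (x + s • z)) S ν := fun s =>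
    ((hcomp s).continuousOn.integrableOn_compact (isCompact_closedBall 0 1)).mono_set hS
  refine (hasDerivAt_integral_of_dominated_loc_of_deriv_le (bound := fun _ => C)
    (F := fun (s : ℝ) z => w (x + s • z)) (F' := fun (s : ℝ) z => fderiv ℝ w (x + s • z) z)
    univ_mem (Eventually.of_forall fun s => (hint s).aestronglyMeasurable) (hint t) ?_ ?_
    ?_ ?_).2
  · exact Continuous.aestronglyMeasurable ((hDc.comp (by fun_prop)).clm_apply continuous_id)
  · refine (ae_restrict_iff' hSm).2 (Eventually.of_forall fun z hz s _ => ?_)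
    have h1 : ‖z‖ ≤ 1 := by simpa using hS hz
    calc ‖fderiv ℝ w (x + s • z) z‖ ≤ ‖fderiv ℝ w (x + s • z)‖ * ‖z‖ :=
          ContinuousLinearMap.le_opNorm _ _
      _ ≤ ‖fderiv ℝ w (x + s • z)‖ * 1 := by gcongr
      _ ≤ C := by simpa using hC _
  · exact integrableOn_const hSfin.ne
  · refine Eventually.of_forall fun z s _ => ?_
    have h1 : HasDerivAt (fun s : ℝ => x + s • z) z s := by
      simpa using ((hasDerivAt_id s).smul_const z).const_add x
    exact ((hw.differentiable (by norm_num)) (x + s • z)).hasFDerivAt.comp_hasDerivAt s h1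

theorem setLIntegral_dilation_le (ν : Measure E) [ν.IsAddHaarMeasure] {f : E → ℝ≥0∞}
    (hf : Measurable f) {S : Set E} (hSm : MeasurableSet S) (hS : S ⊆ closedBall 0 1) (x : E)
    {ρ : ℝ} (hρ : 0 < ρ) :
    ∫⁻ z in S, f (x + ρ • z) ∂ν ≤
      ENNReal.ofReal ((ρ ^ finrank ℝ E)⁻¹) * ∫⁻ y in closedBall x ρ, f y ∂ν := by
  have hm : Measurable ((closedBall x ρ).indicator f) := hf.indicator isClosed_closedBall.measurableSet
  calc ∫⁻ z in S, f (x + ρ • z) ∂ν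
      ≤ ∫⁻ z in S, (closedBall x ρ).indicator f (x + ρ • z) ∂ν := by
        refine setLIntegral_mono' hSm fun z hz => ?_
        have h1 : ‖z‖ ≤ 1 := by simpa using hS hz
        rw [indicator_of_mem]
        rw [mem_closedBall, dist_eq_norm, add_sub_cancel_left, norm_smul, Real.norm_of_nonneg hρ.le]
        nlinarith
    _ ≤ ∫⁻ z, (closedBall x ρ).indicator f (x + ρ • z) ∂ν := setLIntegral_le_lintegral _ _
    _ = ∫⁻ y, (closedBall x ρ).indicator f (x + y) ∂(ν.map (ρ • ·)) := by
        exact (lintegral_map (hm.comp (measurable_const_add x)) (measurable_const_smul ρ)).symm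
    _ = _ := by
        rw [Measure.map_addHaar_smul ν hρ.ne', lintegral_smul_measure,
          lintegral_add_left_eq_self (μ := ν) ((closedBall x ρ).indicator f) x,
          lintegral_indicator isClosed_closedBall.measurableSet, abs_of_pos (by positivity),
          smul_eq_mul]

theorem norm_setIntegral_fderiv_dilation_le (ν : Measure E) [ν.IsAddHaarMeasure] {w : E → ℝ}
    (hw : ContDiff ℝ 1 w) {S : Set E} (hSm : MeasurableSet S) (hS : S ⊆ closedBall 0 1) (x : E)
    {r : ℝ} (hr : 1 < r) {ρ g : ℝ} (hρ : 0 < ρ) (hg : 0 ≤ g)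
    (h : ∫⁻ y in closedBall x ρ, ‖fderiv ℝ w y‖ₑ ^ r ∂ν ≤ ENNReal.ofReal g) :
    ‖∫ z in S, fderiv ℝ w (x + ρ • z) z ∂ν‖ ≤
      ν.real S ^ (1 - 1 / r) * ((ρ ^ finrank ℝ E)⁻¹ * g) ^ (1 / r) := by
  have hDc : Continuous (fderiv ℝ w) := hw.continuous_fderiv (by norm_num)
  have hSfin : ν S ≠ ∞ :=
    ((measure_mono hS).trans_lt (isCompact_closedBall 0 1).measure_lt_top).ne
  have hpq : r.HolderConjugate (r.conjExponent) := Real.HolderConjugate.conjExponent hr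
  have hq : 1 / r.conjExponent = 1 - 1 / r := by
    have := hpq.inv_add_inv_eq_one
    simp only [one_div]; linarith
  have hr' : 0 ≤ 1 - 1 / r := by rw [← hq]; exact one_div_nonneg.2 hpq.symm.nonneg
  have key : ‖∫ z in S, fderiv ℝ w (x + ρ • z) z ∂ν‖ₑ ≤
      ENNReal.ofReal (ν.real S ^ (1 - 1 / r) * ((ρ ^ finrank ℝ E)⁻¹ * g) ^ (1 / r)) := by
    calc ‖∫ z in S, fderiv ℝ w (x + ρ • z) z ∂ν‖ₑ
        ≤ ∫⁻ z in S, ‖fderiv ℝ w (x + ρ • z) z‖ₑ ∂ν := enorm_integral_le_lintegral_enorm _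
      _ ≤ ∫⁻ z in S, ((fun z : E => ‖fderiv ℝ w (x + ρ • z)‖ₑ) * fun _ : E => (1 : ℝ≥0∞)) z ∂ν := by
          refine setLIntegral_mono' hSm fun z hz => ?_
          have h1 : ‖z‖ ≤ 1 := by simpa using hS hz
          have h2 : ‖z‖ₑ ≤ 1 := by
            rw [← ofReal_norm, ENNReal.ofReal_le_one]; exact h1
          calc ‖fderiv ℝ w (x + ρ • z) z‖ₑ ≤ ‖fderiv ℝ w (x + ρ • z)‖ₑ * ‖z‖ₑ :=
                ContinuousLinearMap.le_opENorm _ _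
            _ ≤ _ := by simp only [Pi.mul_apply]; gcongr
      _ ≤ (∫⁻ z in S, ‖fderiv ℝ w (x + ρ • z)‖ₑ ^ r ∂ν) ^ (1 / r) *
            (∫⁻ z in S, 1 ^ r.conjExponent ∂ν) ^ (1 / r.conjExponent) :=
          ENNReal.lintegral_mul_le_Lp_mul_Lq _ hpq
            (Continuous.measurable (by fun_prop)).aemeasurable aemeasurable_const
      _ ≤ (ENNReal.ofReal ((ρ ^ finrank ℝ E)⁻¹) * ENNReal.ofReal g) ^ (1 / r) *
            (ν S) ^ (1 - 1 / r) := by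
          rw [hq]
          simp only [ENNReal.one_rpow, lintegral_const, Measure.restrict_apply_univ, one_mul]
          gcongr
          refine (setLIntegral_dilation_le ν (f := fun y => ‖fderiv ℝ w y‖ₑ ^ r)
            (Measurable.pow_const (by fun_prop) r) hSm hS x hρ).trans ?_
          gcongr
      _ = _ := by
          rw [← ENNReal.ofReal_mul (by positivity), ENNReal.ofReal_rpow_of_nonneg (by positivity)
            (by positivity), mul_comm, ENNReal.ofReal_mul (by positivity),
            ← ENNReal.ofReal_rpow_of_nonneg measureReal_nonneg hr', ofReal_measureReal hSfin]
  rw [← ofReal_norm] at key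
  exact (ENNReal.ofReal_le_ofReal_iff (by positivity)).1 key

/-- If `w x ≥ 1` and the total energy of `w` is at most `κ R ^ (d - r)`, then some ball about `x`
of radius at most `R` carries a definite share of the energy. -/
theorem exists_closedBall_lintegral_fderiv_ge (ν : Measure E) [ν.IsAddHaarMeasure] {r δ : ℝ}
    (hr : 1 < r) (hrd : r < finrank ℝ E) (hδ : 0 < δ) :
    ∃ κ > (0 : ℝ), ∃ c > (0 : ℝ), ∀ w : E → ℝ, ContDiff ℝ 1 w → HasCompactSupport w →
      ∀ R > (0 : ℝ), ∫⁻ y, ‖fderiv ℝ w y‖ₑ ^ r ∂ν ≤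
        ENNReal.ofReal (κ * R ^ ((finrank ℝ E : ℝ) - r)) →
      ∀ x, 1 ≤ w x → ∃ ρ > 0, ρ ≤ R ∧
        ENNReal.ofReal (c * ρ ^ ((finrank ℝ E : ℝ) - r) * (ρ / R) ^ δ) ≤
          ∫⁻ y in closedBall x ρ, ‖fderiv ℝ w y‖ₑ ^ r ∂ν := by
  have hr0 : 0 < r := by linarith
  set d := finrank ℝ E with hd
  have : Nontrivial E := by
    refine Module.nontrivial_of_finrank_pos (R := ℝ) ?_
    have : (0 : ℝ) < d := by linarith
    exact_mod_cast this
  obtain ⟨z₀, hz₀⟩ := exists_norm_eq E (show (0 : ℝ) ≤ 1 / 2 by norm_num)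
  let S : Set E := ball z₀ (1 / 4)
  have hS : ∀ z ∈ S, 1 / 4 ≤ ‖z‖ ∧ ‖z‖ ≤ 1 := by
    intro z hz
    have h1 : ‖z - z₀‖ < 1 / 4 := by simpa [S, dist_eq_norm] using hz
    have h2 := abs_le.1 (abs_norm_sub_norm_le z z₀)
    constructor <;> linarith [h2.1, h2.2]
  have hSm : MeasurableSet S := measurableSet_ball
  have hS1 : S ⊆ closedBall 0 1 := fun z hz => by simpa using (hS z hz).2
  set V := ν.real S with hV
  have hV0 : 0 < V := ENNReal.toReal_pos (measure_ball_pos ν z₀ (by norm_num)).ne'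
    measure_ball_lt_top.ne
  set C := V ^ (1 - 1 / r) with hC
  have hC0 : 0 < C := by positivity
  have hq : 0 < d / r - 1 := by rw [sub_pos, one_lt_div hr0]; exact hrd
  set k₁ := V * (d / r - 1) / (4 * C) with hk₁
  set k₂ := V * (δ / r) / (4 * C) with hk₂
  have hk₁0 : 0 < k₁ := by positivity
  have hk₂0 : 0 < k₂ := by positivity
  refine ⟨k₁ ^ r, by positivity, k₂ ^ r, by positivity, fun w hw hc R hR hM x hx => ?_⟩
  by_contra! hcon
  let A : ℝ → ℝ := fun t => ∫ z in S, w (x + t • z) ∂ν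
  have hA : ∀ t, HasDerivAt A (∫ z in S, fderiv ℝ w (x + t • z) z ∂ν) t :=
    hasDerivAt_setIntegral_dilation ν hw hc hSm hS1 x
  have hA0 : V ≤ A 0 := by
    simp only [A, zero_smul, add_zero, setIntegral_const, smul_eq_mul, ← hV]
    nlinarith
  have hnear : A 0 - A R ≤ V / 4 := by
    have := sub_le_sub_of_norm_deriv_le (B := fun t => V / 4 * (t / R) ^ (δ / r))
      (B' := fun t => C * (k₂ * ((t / R) ^ (δ / r) / t))) hR.le hA ?_ ?_ ?_
    · refine this.trans ?_
      simp [div_self hR.ne', Real.zero_rpow (div_pos hδ hr0).ne']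
    · refine (Continuous.continuousOn ?_)
      exact continuous_const.mul ((continuous_id.div_const R).rpow_const
        fun _ => Or.inr (by positivity))
    · intro t ht
      have ht0 := ht.1
      refine ((((hasDerivAt_id' t).div_const R).rpow_const (p := δ / r)
        (Or.inl (div_pos ht.1 hR).ne')).const_mul (V / 4)).congr_deriv ?_
      rw [Real.rpow_sub_one (div_pos ht.1 hR).ne', hk₂]
      field_simp
    · intro t ht
      rw [← rpow_inv_mul_div_rpow_eq hr0 hk₂0.le hR ht.1]
      have ht0 := ht.1
      exact norm_setIntegral_fderiv_dilation_le ν hw hSm hS1 x hr ht.1 (by positivity)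
        (hcon t ht.1 ht.2.le).le
  obtain ⟨T, hRT, hT⟩ : ∃ T, R ≤ T ∧ A T = 0 := by
    obtain ⟨L, hL⟩ := hc.isCompact.isBounded.exists_norm_le
    refine ⟨max R (4 * (‖x‖ + L + 1)), le_max_left _ _, ?_⟩
    set T := max R (4 * (‖x‖ + L + 1)) with hT
    have hTL : 4 * (‖x‖ + L + 1) ≤ T := le_max_right _ _
    have hT0 : 0 < T := hR.trans_le (le_max_left _ _)
    refine setIntegral_eq_zero_of_forall_eq_zero fun z hz => ?_
    by_contra hne
    have h1 := hL _ (subset_tsupport w hne)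
    have h2 : ‖T • z‖ ≤ ‖x + T • z‖ + ‖x‖ := by
      simpa using norm_sub_le (x + T • z) x
    rw [norm_smul, Real.norm_of_nonneg hT0.le] at h2
    nlinarith [(hS z hz).1]
  have hfar : A R - A T ≤ V / 4 := by
    have := sub_le_sub_of_norm_deriv_le
      (B := fun t => -(V / 4 * R ^ (d / r - 1) * t ^ (1 - d / r)))
      (B' := fun t => C * (k₁ * R ^ (d / r - 1) * t ^ (-(d / r) : ℝ))) hRT hA ?_ ?_ ?_
    · refine this.trans ?_
      have h1 : R ^ (d / r - 1) * R ^ (1 - d / r) = 1 := by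
        rw [← Real.rpow_add hR]; simp
      have h2 : 0 ≤ V / 4 * R ^ (d / r - 1) * T ^ (1 - d / r) := by
        have : 0 < T := hR.trans_le hRT
        positivity
      simp only [mul_assoc, h1] at h2 ⊢
      linarith
    · intro t ht
      exact (ContinuousAt.neg (continuousAt_const.mul (Real.continuousAt_rpow_const _ _
        (Or.inl (hR.trans_le ht.1).ne')))).continuousWithinAt
    · intro t ht
      refine ((Real.hasDerivAt_rpow_const (p := 1 - d / r)
        (Or.inl (hR.trans ht.1).ne')).const_mul (V / 4 * R ^ (d / r - 1))).neg.congr_deriv ?_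
      rw [hk₁, show (1 - d / r - 1 : ℝ) = -(d / r) by ring]
      field_simp
      ring
    · intro t ht
      have ht0 := hR.trans ht.1
      rw [← rpow_inv_mul_rpow_eq hr0 hk₁0.le hR ht0]
      exact norm_setIntegral_fderiv_dilation_le ν hw hSm hS1 x hr ht0 (by positivity)
        ((setLIntegral_le_lintegral _ _).trans hM)
  linarith

theorem measure_superlevel_le_of_lintegral_fderiv_le (ν : Measure E) [ν.IsAddHaarMeasure]
    {r s : ℝ} (hr : 1 < r) (hrs : r < s) (hrd : r < finrank ℝ E) :
    ∃ C > (0 : ℝ), ∀ (μ : Measure E) (K : ℝ), 0 < K →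
      (∀ (x : E) (ρ : ℝ), 0 < ρ →
        μ (ball x ρ) ≤ ENNReal.ofReal (K * ρ ^ (s / r * ((finrank ℝ E : ℝ) - r)))) →
      ∀ w : E → ℝ, ContDiff ℝ 1 w → HasCompactSupport w →
      ∀ M > (0 : ℝ), ∫⁻ y, ‖fderiv ℝ w y‖ₑ ^ r ∂ν ≤ ENNReal.ofReal M →
      μ {x | 1 ≤ w x} ≤ ENNReal.ofReal (C * K * M ^ (s / r)) := by
  have hr0 : 0 < r := by linarith
  set d := finrank ℝ E with hd
  have hdr : 0 < (d : ℝ) - r := by linarith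
  set α := s / r * ((d : ℝ) - r) with hα
  have hsr : 1 < s / r := (one_lt_div hr0).2 hrs
  have hδ : 0 < α - (d - r) := by rw [hα]; nlinarith
  obtain ⟨κ, hκ, c, hc, hball⟩ := exists_closedBall_lintegral_fderiv_ge ν hr hrd hδ
  refine ⟨6 ^ α / c * (κ * (κ⁻¹) ^ (s / r)), by positivity,
    fun μ K hK hμ w hw hwc M hM hwM => ?_⟩
  set R := (M / κ) ^ (1 / ((d : ℝ) - r)) with hR
  have hR0 : 0 < R := by positivity
  have hRd : κ * R ^ ((d : ℝ) - r) = M := by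
    rw [hR, ← Real.rpow_mul (by positivity), one_div_mul_cancel hdr.ne', Real.rpow_one]
    field_simp
  have hRα : R ^ α = (κ⁻¹) ^ (s / r) * M ^ (s / r) := by
    rw [hR, ← Real.rpow_mul (by positivity), ← Real.mul_rpow (by positivity) hM.le, hα]
    congr 1
    · ring
    · field_simp
  have hex : ∀ x, ∃ ρ, 1 ≤ w x → 0 < ρ ∧ ρ ≤ R ∧
      ENNReal.ofReal (c * ρ ^ ((d : ℝ) - r) * (ρ / R) ^ (α - (d - r))) ≤
        ∫⁻ y in closedBall x ρ, ‖fderiv ℝ w y‖ₑ ^ r ∂ν := by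
    intro x
    by_cases hx : 1 ≤ w x
    · obtain ⟨ρ, h1, h2, h3⟩ := hball w hw hwc R hR0 (by rw [hRd]; exact hwM) x hx
      exact ⟨ρ, fun _ => ⟨h1, h2, h3⟩⟩
    · exact ⟨0, fun h => absurd h hx⟩
  choose ρ hρ using hex
  obtain ⟨u, hu, hdisj, hcov⟩ := Vitali.exists_disjoint_subfamily_covering_enlargement_closedBall
    {x | 1 ≤ w x} id ρ R (fun x hx => (hρ x hx).2.1) 5 (by norm_num)
  simp only [id] at hdisj hcov
  have hcount : u.Countable := hdisj.countable_of_nonempty_interior fun x hx =>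
    ⟨x, ball_subset_interior_closedBall (mem_ball_self (hρ x (hu hx)).1)⟩
  have hone : ∀ x ∈ u, μ (closedBall x (5 * ρ x)) ≤
      ENNReal.ofReal (K * 6 ^ α / c * R ^ (α - (d - r))) *
        ∫⁻ y in closedBall x (ρ x), ‖fderiv ℝ w y‖ₑ ^ r ∂ν := by
    intro x hx
    obtain ⟨h1, -, h3⟩ := hρ x (hu hx)
    calc μ (closedBall x (5 * ρ x)) ≤ μ (ball x (6 * ρ x)) :=
          measure_mono (closedBall_subset_ball (by linarith))
      _ ≤ ENNReal.ofReal (K * (6 * ρ x) ^ α) := hμ _ _ (by positivity)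
      _ = ENNReal.ofReal (K * 6 ^ α / c * R ^ (α - (d - r))) *
          ENNReal.ofReal (c * ρ x ^ ((d : ℝ) - r) * (ρ x / R) ^ (α - (d - r))) := by
        rw [← ENNReal.ofReal_mul (by positivity)]
        congr 1
        have h4 : ρ x ^ α = ρ x ^ ((d : ℝ) - r) * ρ x ^ (α - (d - r)) := by
          rw [← Real.rpow_add h1]; congr 1; ring
        rw [Real.mul_rpow (by norm_num) h1.le, Real.div_rpow h1.le hR0.le, h4]
        field_simp
      _ ≤ _ := by gcongr
  calc μ {x | 1 ≤ w x} ≤ μ (⋃ x ∈ u, closedBall x (5 * ρ x)) := by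
        refine measure_mono fun x hx => ?_
        obtain ⟨b, hb, hxb⟩ := hcov x hx
        exact mem_biUnion hb (hxb (mem_closedBall_self (hρ x hx).1.le))
    _ ≤ ∑' x : u, μ (closedBall x (5 * ρ x)) := measure_biUnion_le μ hcount _
    _ ≤ ∑' x : u, ENNReal.ofReal (K * 6 ^ α / c * R ^ (α - (d - r))) *
        ∫⁻ y in closedBall x (ρ x), ‖fderiv ℝ w y‖ₑ ^ r ∂ν :=
      ENNReal.tsum_le_tsum fun x => hone x x.2
    _ = ENNReal.ofReal (K * 6 ^ α / c * R ^ (α - (d - r))) *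
        ∫⁻ y in ⋃ x ∈ u, closedBall x (ρ x), ‖fderiv ℝ w y‖ₑ ^ r ∂ν := by
      rw [ENNReal.tsum_mul_left, lintegral_biUnion hcount
        (fun x _ => isClosed_closedBall.measurableSet) hdisj]
    _ ≤ ENNReal.ofReal (K * 6 ^ α / c * R ^ (α - (d - r))) * ENNReal.ofReal M := by
      gcongr
      exact (setLIntegral_le_lintegral _ _).trans hwM
    _ = _ := by
      rw [← ENNReal.ofReal_mul (by positivity)]
      congr 1
      have h4 : R ^ α = R ^ ((d : ℝ) - r) * R ^ (α - (d - r)) := by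
        rw [← Real.rpow_add hR0]; congr 1; ring
      calc K * 6 ^ α / c * R ^ (α - (d - r)) * M
          = K * 6 ^ α / c * κ * R ^ α := by rw [h4, ← hRd]; ring
        _ = _ := by rw [hRα]; ring

/-- The weak-type form of the trace inequality. -/
theorem measure_superlevel_le (ν : Measure E) [ν.IsAddHaarMeasure]
    {r s : ℝ} (hr : 1 < r) (hrs : r < s) (hrd : r < finrank ℝ E) :
    ∃ C > (0 : ℝ), ∀ (μ : Measure E) (K : ℝ), 0 < K →
      (∀ (x : E) (ρ : ℝ), 0 < ρ →
        μ (ball x ρ) ≤ ENNReal.ofReal (K * ρ ^ (s / r * ((finrank ℝ E : ℝ) - r)))) →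
      ∀ w : E → ℝ, ContDiff ℝ 1 w → HasCompactSupport w →
      μ {x | 1 ≤ w x} ≤
        ENNReal.ofReal (C * K) * (∫⁻ y, ‖fderiv ℝ w y‖ₑ ^ r ∂ν) ^ (s / r) := by
  have hsr : 0 < s / r := div_pos (by linarith) (by linarith)
  obtain ⟨C, hC, h⟩ := measure_superlevel_le_of_lintegral_fderiv_le ν hr hrs hrd
  refine ⟨C, hC, fun μ K hK hμ w hw hwc => ?_⟩
  set I := ∫⁻ y, ‖fderiv ℝ w y‖ₑ ^ r ∂ν with hI
  rcases eq_or_ne I ∞ with htop | htop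
  · rw [htop, ENNReal.top_rpow_of_pos hsr, ENNReal.mul_top]
    · exact le_top
    · simpa using by positivity
  have hlim : Tendsto (fun ε : ℝ => ENNReal.ofReal (C * K * (I.toReal + ε) ^ (s / r)))
      (𝓝[>] 0) (𝓝 (ENNReal.ofReal (C * K * (I.toReal + 0) ^ (s / r)))) := by
    have hcont : Continuous fun ε : ℝ => ENNReal.ofReal (C * K * (I.toReal + ε) ^ (s / r)) :=
      ENNReal.continuous_ofReal.comp (continuous_const.mul
        ((continuous_const.add continuous_id).rpow_const fun _ => Or.inr hsr.le))
    exact (hcont.tendsto 0).mono_left nhdsWithin_le_nhds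
  have hle : μ {x | 1 ≤ w x} ≤ ENNReal.ofReal (C * K * (I.toReal + 0) ^ (s / r)) := by
    refine ge_of_tendsto hlim (eventually_mem_nhdsWithin.mono fun ε hε => ?_)
    have hε : 0 < ε := hε
    refine h μ K hK hμ w hw hwc _ (by positivity) ?_
    rw [ENNReal.ofReal_add ENNReal.toReal_nonneg hε.le, ENNReal.ofReal_toReal htop]
    exact le_self_add
  rwa [add_zero, ENNReal.ofReal_mul (by positivity),
    ← ENNReal.ofReal_rpow_of_nonneg ENNReal.toReal_nonneg hsr.le,
    ENNReal.ofReal_toReal htop] at hle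

/-- Capacitary weak-type bound applied to a smooth truncation of `v` between two levels. -/
theorem setLIntegral_layer_le (ν : Measure E) [ν.IsAddHaarMeasure]
    {r s : ℝ} (hr : 1 < r) (hrs : r < s) (hrd : r < finrank ℝ E) :
    ∃ C > (0 : ℝ), ∀ (μ : Measure E) (K : ℝ), 0 < K →
      (∀ (x : E) (ρ : ℝ), 0 < ρ →
        μ (ball x ρ) ≤ ENNReal.ofReal (K * ρ ^ (s / r * ((finrank ℝ E : ℝ) - r)))) →
      ∀ v : E → ℝ, ContDiff ℝ 1 v → HasCompactSupport v → ∀ a > (0 : ℝ),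
      ∫⁻ x in {x | v x ^ 2 ∈ Ico (2 * a) (4 * a)}, ‖v x‖ₑ ^ s ∂μ ≤
        ENNReal.ofReal (C * K) *
          (∫⁻ y in {x | v x ^ 2 ∈ Ico a (2 * a)}, ‖fderiv ℝ v y‖ₑ ^ r ∂ν) ^ (s / r) := by
  have hr0 : 0 < r := by linarith
  have hs0 : 0 < s := by linarith
  have hsr : 0 < s / r := div_pos hs0 hr0
  obtain ⟨C, hC, hweak⟩ := measure_superlevel_le ν hr hrs hrd
  obtain ⟨L, hL, htrunc⟩ := exists_norm_fderiv_smoothTransition_le (E := E)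
  refine ⟨2 ^ s * L ^ s * C, by positivity, fun μ K hK hμ v hv hvc a ha => ?_⟩
  set w : E → ℝ := fun x => Real.smoothTransition (v x ^ 2 / a - 1) with hw
  have hw1 : ContDiff ℝ 1 w := (Real.smoothTransition.contDiff (n := 1)).comp
    (((hv.pow 2).div_const a).sub contDiff_const)
  have hwc : HasCompactSupport w :=
    hvc.comp_left (g := fun t => Real.smoothTransition (t ^ 2 / a - 1))
      (Real.smoothTransition.zero_of_nonpos (by norm_num))
  have hvm : Measurable v := hv.continuous.measurable
  have hms : ∀ b c : ℝ, MeasurableSet {x | v x ^ 2 ∈ Ico b c} := fun b c =>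
    (hvm.pow_const 2) measurableSet_Ico
  set J := ∫⁻ y in {x | v x ^ 2 ∈ Ico a (2 * a)}, ‖fderiv ℝ v y‖ₑ ^ r ∂ν with hJ
  have hgrad : ∫⁻ y, ‖fderiv ℝ w y‖ₑ ^ r ∂ν ≤
      ENNReal.ofReal (L * a ^ (-(1 / 2) : ℝ)) ^ r * J := by
    rw [hJ, ← lintegral_const_mul' _ _ (ENNReal.rpow_ne_top_of_nonneg hr0.le ENNReal.ofReal_ne_top),
      ← lintegral_indicator (hms _ _)]
    refine lintegral_mono fun y => ?_
    have h1 := htrunc v hv a ha y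
    by_cases hy : y ∈ {x | v x ^ 2 ∈ Ico a (2 * a)}
    · rw [indicator_of_mem hy] at h1 ⊢
      rw [← ENNReal.mul_rpow_of_nonneg _ _ hr0.le]
      gcongr
      rw [← ofReal_norm, ← ofReal_norm, ← ENNReal.ofReal_mul (by positivity)]
      exact ENNReal.ofReal_le_ofReal h1
    · rw [indicator_of_notMem hy] at h1 ⊢
      have h2 : fderiv ℝ w y = 0 := norm_le_zero_iff.1 h1
      rw [← ofReal_norm, h2, norm_zero, ENNReal.ofReal_zero, ENNReal.zero_rpow_of_pos hr0]
  have hsub : {x | v x ^ 2 ∈ Ico (2 * a) (4 * a)} ⊆ {x | 1 ≤ w x} := by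
    intro x hx
    refine (Real.smoothTransition.one_of_one_le ?_).ge
    have : 2 ≤ v x ^ 2 / a := by rw [le_div_iff₀ ha]; exact hx.1
    linarith
  calc ∫⁻ x in {x | v x ^ 2 ∈ Ico (2 * a) (4 * a)}, ‖v x‖ₑ ^ s ∂μ
      ≤ ∫⁻ x in {x | v x ^ 2 ∈ Ico (2 * a) (4 * a)},
          ENNReal.ofReal (2 * a ^ (1 / 2 : ℝ)) ^ s ∂μ := by
        refine setLIntegral_mono' (hms _ _) fun x hx => ?_
        gcongr
        rw [← ofReal_norm]
        refine ENNReal.ofReal_le_ofReal (abs_le_of_sq_le_sq ?_ (by positivity))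
        rw [mul_pow, ← Real.sqrt_eq_rpow, Real.sq_sqrt ha.le]
        linarith [hx.2]
    _ ≤ ENNReal.ofReal (2 * a ^ (1 / 2 : ℝ)) ^ s * μ {x | 1 ≤ w x} := by
        rw [setLIntegral_const]
        gcongr
    _ ≤ ENNReal.ofReal (2 * a ^ (1 / 2 : ℝ)) ^ s * (ENNReal.ofReal (C * K) *
          (ENNReal.ofReal (L * a ^ (-(1 / 2) : ℝ)) ^ r * J) ^ (s / r)) := by
        gcongr
        exact (hweak μ K hK hμ w hw1 hwc).trans (by gcongr)
    _ = ENNReal.ofReal (2 ^ s * L ^ s * C * K) * J ^ (s / r) := by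
        rw [ENNReal.mul_rpow_of_nonneg _ _ hsr.le, ← ENNReal.rpow_mul, mul_div_cancel₀ _ hr0.ne',
          ENNReal.ofReal_rpow_of_nonneg (by positivity) hs0.le,
          ENNReal.ofReal_rpow_of_nonneg (by positivity) hs0.le, ← mul_assoc, ← mul_assoc,
          ← ENNReal.ofReal_mul (by positivity), ← ENNReal.ofReal_mul (by positivity)]
        congr 2
        have h1 : a ^ (1 / 2 : ℝ) * a ^ (-(1 / 2) : ℝ) = 1 := by
          rw [← Real.rpow_add ha]; norm_num
        have h2 : (2 * a ^ (1 / 2 : ℝ)) ^ s * (L * a ^ (-(1 / 2) : ℝ)) ^ s = 2 ^ s * L ^ s := by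
          rw [← Real.mul_rpow (by positivity) (by positivity),
            ← Real.mul_rpow (by positivity) (by positivity)]
          congr 1
          linear_combination (2 * L) * h1
        linear_combination (C * K) * h2

/-- The trace inequality for `C¹` functions, with lower Lebesgue integrals. -/
theorem lintegral_rpow_le_of_measure_ball_le (ν : Measure E) [ν.IsAddHaarMeasure]
    {r s : ℝ} (hr : 1 < r) (hrs : r < s) (hrd : r < finrank ℝ E) :
    ∃ C > (0 : ℝ), ∀ (μ : Measure E) (K : ℝ), 0 < K →
      (∀ (x : E) (ρ : ℝ), 0 < ρ →
        μ (ball x ρ) ≤ ENNReal.ofReal (K * ρ ^ (s / r * ((finrank ℝ E : ℝ) - r)))) →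
      ∀ v : E → ℝ, ContDiff ℝ 1 v → HasCompactSupport v →
      ∫⁻ x, ‖v x‖ₑ ^ s ∂μ ≤
        ENNReal.ofReal (C * K) * (∫⁻ y, ‖fderiv ℝ v y‖ₑ ^ r ∂ν) ^ (s / r) := by
  have hs0 : 0 < s := by linarith
  have hsr : 1 ≤ s / r := (one_le_div (by linarith)).2 hrs.le
  obtain ⟨C, hC, hlayer⟩ := setLIntegral_layer_le ν hr hrs hrd
  refine ⟨C, hC, fun μ K hK hμ v hv hvc => ?_⟩
  have hvm : Measurable v := hv.continuous.measurable
  have hmono : Monotone fun k : ℤ => (2 : ℝ) ^ k := zpow_right_mono₀ (by norm_num)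
  have hsucc : ∀ k : ℤ, 2 * (2 : ℝ) ^ k = 2 ^ (k + 1) := fun k => by
    rw [zpow_add_one₀ (by norm_num)]; ring
  calc ∫⁻ x, ‖v x‖ₑ ^ s ∂μ
      = ∫⁻ x in Function.support v, ‖v x‖ₑ ^ s ∂μ := by
        rw [← lintegral_indicator (measurableSet_support hvm)]
        refine lintegral_congr fun x => ?_
        by_cases hx : v x = 0 <;> simp [hx, hs0]
    _ ≤ ∫⁻ x in ⋃ k : ℤ, {x | v x ^ 2 ∈ Ico (2 * (2 : ℝ) ^ k) (4 * 2 ^ k)},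
          ‖v x‖ₑ ^ s ∂μ := by
        refine lintegral_mono_set fun x hx => ?_
        obtain ⟨k, hk⟩ := exists_mem_Ico_zpow (y := (2 : ℝ)) (pow_pos (abs_pos.2 hx) 2)
          (by norm_num)
        rw [sq_abs] at hk
        refine mem_iUnion.2 ⟨k - 1, ?_⟩
        have h1 := hsucc (k - 1)
        have h2 := hsucc k
        rw [sub_add_cancel] at h1
        refine ⟨h1.trans_le hk.1, hk.2.trans_eq ?_⟩
        linarith
    _ ≤ ∑' k : ℤ, ∫⁻ x in {x | v x ^ 2 ∈ Ico (2 * (2 : ℝ) ^ k) (4 * 2 ^ k)},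
          ‖v x‖ₑ ^ s ∂μ := lintegral_iUnion_le _ _
    _ ≤ ∑' k : ℤ, ENNReal.ofReal (C * K) *
          (∫⁻ y in {x | v x ^ 2 ∈ Ico ((2 : ℝ) ^ k) (2 * 2 ^ k)},
            ‖fderiv ℝ v y‖ₑ ^ r ∂ν) ^ (s / r) :=
        ENNReal.tsum_le_tsum fun k => hlayer μ K hK hμ v hv hvc _ (by positivity)
    _ ≤ ENNReal.ofReal (C * K) *
          (∑' k : ℤ, ∫⁻ y in {x | v x ^ 2 ∈ Ico ((2 : ℝ) ^ k) (2 * 2 ^ k)},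
            ‖fderiv ℝ v y‖ₑ ^ r ∂ν) ^ (s / r) := by
        rw [ENNReal.tsum_mul_left]
        gcongr
        exact tsum_rpow_le_rpow_tsum _ hsr
    _ ≤ _ := by
        gcongr
        rw [← lintegral_iUnion]
        · exact setLIntegral_le_lintegral _ _
        · exact fun k => (hvm.pow_const 2) measurableSet_Ico
        · intro i j hij
          simp only [hsucc]
          exact (hmono.pairwise_disjoint_on_Ico_succ hij).preimage (fun x => v x ^ 2)

end Trace

/-- Adams trace inequality: if `μ` is a positive Radon measure supported in a
bounded set `Ω ⊆ ℝⁿ` with `μ(B_ρ(x)) ≤ K ρ^{α₀}` for all balls, where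
`α₀ = (s/r)(n-r)`, `1 < r < s < ∞`, `r < n`, then
`(∫_Ω |v|^s dμ)^{1/s} ≤ C(n,s,r) K^{1/s} (∫_Ω |Dv|^r dx)^{1/r}`
for all `v ∈ W₀^{1,r}(Ω)`. -/
theorem adams_trace (n : ℕ) (hn : 2 ≤ n) (s r : ℝ)
    (hr : 1 < r) (hrs : r < s) (hrn : r < n) :
    ∃ C > (0 : ℝ), ∀ (Ω : Set (EuclideanSpace ℝ (Fin n))), Bornology.IsBounded Ω →
      ∀ (μ : Measure (EuclideanSpace ℝ (Fin n))) (K : ℝ), 0 < K →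
        μ Ωᶜ = 0 →
        (∀ (x : EuclideanSpace ℝ (Fin n)) (ρ : ℝ), 0 < ρ →
          μ (ball x ρ) ≤ ENNReal.ofReal (K * ρ ^ (s / r * ((n : ℝ) - r)))) →
        ∀ v : EuclideanSpace ℝ (Fin n) → ℝ, ContDiff ℝ (⊤ : ℕ∞) v →
          HasCompactSupport v → tsupport v ⊆ Ω →
          (∫ x in Ω, |v x| ^ s ∂μ) ^ (1 / s) ≤
            C * K ^ (1 / s) * (∫ x in Ω, ‖gradient v x‖ ^ r) ^ (1 / r) := by
  have hs0 : 0 < s := by linarith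
  have hr0 : 0 < r := by linarith
  obtain ⟨C, hC, h⟩ := lintegral_rpow_le_of_measure_ball_le
    (volume : Measure (EuclideanSpace ℝ (Fin n))) hr hrs (by simpa using hrn)
  rw [finrank_euclideanSpace_fin] at h
  refine ⟨C ^ (1 / s), by positivity, fun Ω _ μ K hK _ hμ v hv hvc hvΩ => ?_⟩
  have hv1 : ContDiff ℝ 1 v := hv.of_le (by exact_mod_cast le_top)
  have hDc : Continuous (fderiv ℝ v) := hv1.continuous_fderiv one_ne_zero
  have hgrad : ∀ x, ‖gradient v x‖ = ‖fderiv ℝ v x‖ := fun x =>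
    LinearIsometryEquiv.norm_map _ _
  simp only [hgrad]
  have hΩ : ∫ x in Ω, ‖fderiv ℝ v x‖ ^ r = ∫ x, ‖fderiv ℝ v x‖ ^ r := by
    refine setIntegral_eq_integral_of_forall_compl_eq_zero fun x hx => ?_
    rw [image_eq_zero_of_notMem_tsupport fun hx' => hx (hvΩ (tsupport_fderiv_subset ℝ hx')),
      norm_zero, Real.zero_rpow hr0.ne']
  rw [hΩ]
  set G := ∫ x, ‖fderiv ℝ v x‖ ^ r with hG
  have hG0 : 0 ≤ G := integral_nonneg fun x => by positivity
  have hint : Integrable fun x => ‖fderiv ℝ v x‖ ^ r :=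
    (hDc.norm.rpow_const fun _ => Or.inr hr0.le).integrable_of_hasCompactSupport
      ((hvc.fderiv ℝ).comp_left (g := fun L => ‖L‖ ^ r) (by simp [hr0.ne']))
  have hGl : ∫⁻ x, ‖fderiv ℝ v x‖ₑ ^ r = ENNReal.ofReal G := by
    rw [hG, ofReal_integral_eq_lintegral_ofReal hint
      (Eventually.of_forall fun x => by positivity)]
    refine lintegral_congr fun x => ?_
    rw [← ofReal_norm, ENNReal.ofReal_rpow_of_nonneg (norm_nonneg _) hr0.le]
  have hmain : ∫ x in Ω, |v x| ^ s ∂μ ≤ C * K * G ^ (s / r) := by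
    rw [integral_eq_lintegral_of_nonneg_ae (Eventually.of_forall fun x => by positivity)
      (Continuous.aestronglyMeasurable (hv1.continuous.abs.rpow_const fun _ => Or.inr hs0.le))]
    refine ENNReal.toReal_le_of_le_ofReal (by positivity) ?_
    calc ∫⁻ x in Ω, ENNReal.ofReal (|v x| ^ s) ∂μ
        ≤ ∫⁻ x, ENNReal.ofReal (|v x| ^ s) ∂μ := setLIntegral_le_lintegral _ _
      _ = ∫⁻ x, ‖v x‖ₑ ^ s ∂μ := by
        refine lintegral_congr fun x => ?_
        rw [← ofReal_norm, ENNReal.ofReal_rpow_of_nonneg (norm_nonneg _) hs0.le,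
          Real.norm_eq_abs]
      _ ≤ ENNReal.ofReal (C * K) * ENNReal.ofReal G ^ (s / r) := by
        rw [← hGl]
        exact h μ K hK hμ v hv1 hvc
      _ = ENNReal.ofReal (C * K * G ^ (s / r)) := by
        rw [ENNReal.ofReal_rpow_of_nonneg hG0 (by positivity),
          ← ENNReal.ofReal_mul (by positivity)]
  calc (∫ x in Ω, |v x| ^ s ∂μ) ^ (1 / s) ≤ (C * K * G ^ (s / r)) ^ (1 / s) :=
        Real.rpow_le_rpow (integral_nonneg fun x => by positivity) hmain (by positivity)
    _ = C ^ (1 / s) * K ^ (1 / s) * G ^ (1 / r) := by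
        rw [Real.mul_rpow (by positivity) (by positivity), Real.mul_rpow hC.le hK.le,
          ← Real.rpow_mul hG0]
        congr 2
        field_simp
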